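/- Let p ≥ 3 be a prime, let q, k ≥ 1 be natural numbers and θ ∈ ℚ_p with |q|_p < |k|_p and |θ − 1|_p < |q|_p² < 1. Then f^{−1}(X) ⊆ X: every x ∈ ℚ_p with x ≠ 2 − q − θ and f(x) ∈ X satisfies x ∈ X. -/

import Mathlib

open scoped Classical

/-- The Potts–Bethe mapping on `ℚ_[p]` (with total division, so defined everywhere). -/
noncomputable def pottsBethe (p : ℕ) [Fact p.Prime] (q k : ℕ) (θ : ℚ_[p]) : ℚ_[p] → ℚ_[p] :=
  fun x => ((θ * x + (q : ℚ_[p]) - 1) / (x + θ + (q : ℚ_[p]) - 2)) ^ k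

/-- The center `x_ξ` associated with a `k`-th root of unity `ξ`. -/
noncomputable def xiCenter (p : ℕ) [Fact p.Prime] (q k : ℕ) (θ ξ : ℚ_[p]) : ℚ_[p] :=
  if ξ = 1 then
    1 - (q : ℚ_[p]) + ((k : ℚ_[p]) - 1) *
      (1 - (q : ℚ_[p]) / 2 + ((k : ℚ_[p]) - 2) * (q : ℚ_[p]) ^ 2 / (6 * (k : ℚ_[p]))) * (θ - 1)
  else
    2 - (q : ℚ_[p]) - θ + (q : ℚ_[p]) * (θ - 1) / (1 - ξ)

/-- The union `X` of the balls of radius `r = ‖q (θ - 1)‖` around the centers `x_ξ`. -/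
def XSet (p : ℕ) [Fact p.Prime] (q k : ℕ) (θ : ℚ_[p]) : Set ℚ_[p] :=
  {x : ℚ_[p] | ∃ ξ : ℚ_[p], ξ ^ k = 1 ∧ ‖x - xiCenter p q k θ ξ‖ < ‖(q : ℚ_[p]) * (θ - 1)‖}


section Helpers
variable {p : ℕ} [Fact p.Prime]

lemma aux_add_lt {a b : ℚ_[p]} {r : ℝ} (ha : ‖a‖ < r) (hb : ‖b‖ < r) : ‖a + b‖ < r :=
  lt_of_le_of_lt (IsUltrametricDist.norm_add_le_max a b) (max_lt ha hb)

lemma aux_add_le {a b : ℚ_[p]} {r : ℝ} (ha : ‖a‖ ≤ r) (hb : ‖b‖ ≤ r) : ‖a + b‖ ≤ r :=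
  (IsUltrametricDist.norm_add_le_max a b).trans (max_le ha hb)

lemma aux_sub_lt {a b : ℚ_[p]} {r : ℝ} (ha : ‖a‖ < r) (hb : ‖b‖ < r) : ‖a - b‖ < r := by
  rw [sub_eq_add_neg]; exact aux_add_lt ha (by rwa [norm_neg])

lemma aux_sub_le {a b : ℚ_[p]} {r : ℝ} (ha : ‖a‖ ≤ r) (hb : ‖b‖ ≤ r) : ‖a - b‖ ≤ r := by
  rw [sub_eq_add_neg]; exact aux_add_le ha (by rwa [norm_neg])

/-- if `b` is strictly smaller than `a`, then `a + b` has the norm of `a` -/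
lemma aux_norm_eq {a b : ℚ_[p]} (h : ‖b - a‖ < ‖a‖) : ‖b‖ = ‖a‖ := by
  have h1 := IsUltrametricDist.norm_add_eq_max_of_norm_ne_norm (x := b - a) (y := a) h.ne
  rw [sub_add_cancel, max_eq_right h.le] at h1
  exact h1

lemma aux_third (hp : 3 ≤ p) {u : ℚ_[p]} (hu : ‖u‖ < 1) : ‖u‖ ≤ 1 / 3 := by
  have h := (Padic.norm_le_pow_iff_norm_lt_pow_add_one u (-1)).2 (by simpa using hu)
  refine h.trans ?_
  rw [zpow_neg_one, one_div]
  exact inv_anti₀ (by norm_num) (by exact_mod_cast hp)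

lemma aux_nat_le (n : ℕ) : ‖(n : ℚ_[p])‖ ≤ 1 := by
  simpa using Padic.norm_int_le_one (p := p) (n : ℤ)

lemma aux_nat_lower (n : ℕ) (hn : n ≠ 0) : 1 ≤ (n : ℝ) * ‖(n : ℚ_[p])‖ := by
  have hp : 0 < p := (Fact.out : p.Prime).pos
  have h : ‖(n : ℚ_[p])‖ = ((p : ℝ) ^ (padicValNat p n))⁻¹ := by
    rw [Padic.norm_eq_zpow_neg_valuation (by exact_mod_cast hn), Padic.valuation_natCast]
    simp
  have h2 : p ^ (padicValNat p n) ≤ n := Nat.le_of_dvd (by omega) pow_padicValNat_dvd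
  have h3 : (p : ℝ) ^ (padicValNat p n) ≤ n := by exact_mod_cast h2
  have h4 : (0 : ℝ) < (p : ℝ) ^ (padicValNat p n) := by positivity
  rw [h, ← div_eq_mul_inv, le_div_iff₀ h4]
  linarith

lemma aux_choose_norm (k j : ℕ) (hk : 1 ≤ k) :
    ‖((k.choose (j + 1) : ℕ) : ℚ_[p])‖ ≤ ‖(k : ℚ_[p])‖ * ((j : ℝ) + 1) := by
  obtain ⟨n, rfl⟩ : ∃ n, k = n + 1 := ⟨k - 1, by omega⟩
  have h := congrArg (fun m : ℕ => ‖(m : ℚ_[p])‖) (Nat.add_one_mul_choose_eq n j)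
  simp only [Nat.cast_mul, norm_mul] at h
  have h1 := aux_nat_lower (p := p) (j + 1) (by omega)
  have h2 := aux_nat_le (p := p) (n.choose j)
  have h3 : ‖((n + 1 : ℕ) : ℚ_[p])‖ * ‖((n.choose j : ℕ) : ℚ_[p])‖ ≤ ‖((n + 1 : ℕ) : ℚ_[p])‖ :=
    mul_le_of_le_one_right (norm_nonneg _) h2
  have h4 := norm_nonneg (((n + 1).choose (j + 1) : ℕ) : ℚ_[p])
  calc _ ≤ ‖(((n + 1).choose (j + 1) : ℕ) : ℚ_[p])‖ * (((j + 1 : ℕ) : ℝ) * ‖((j + 1 : ℕ) : ℚ_[p])‖) :=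
        le_mul_of_one_le_right h4 h1
    _ = (‖(((n + 1).choose (j + 1) : ℕ) : ℚ_[p])‖ * ‖((j + 1 : ℕ) : ℚ_[p])‖) * ((j : ℝ) + 1) := by
        push_cast; ring
    _ ≤ _ := by
        rw [← h]; exact mul_le_mul_of_nonneg_right h3 (by positivity)

lemma aux_choose_two (k : ℕ) : ((k.choose 2 : ℕ) : ℚ_[p]) * 2 = k * (k - 1) := by
  induction k with
  | zero => simp
  | succ n ih =>
    rw [Nat.choose_succ_succ' n 1]; push_cast; rw [add_mul, ih, Nat.choose_one_right]; ring

lemma aux_choose_three (k : ℕ) :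
    ((k.choose 3 : ℕ) : ℚ_[p]) * 6 = k * (k - 1) * (k - 2) := by
  induction k with
  | zero => simp
  | succ n ih =>
    rw [Nat.choose_succ_succ' n 2]; push_cast
    have := aux_choose_two (p := p) n
    linear_combination ih + 3 * this

lemma aux_pow_ineq (j : ℕ) : ((j : ℝ) + 4) * (1 / 3) ^ (j + 2) ≤ 4 / 9 := by
  induction j with
  | zero => norm_num
  | succ n ih =>
    have h : (0 : ℝ) < (1 / 3) ^ (n + 2) := by positivity
    rw [show n + 1 + 2 = (n + 2) + 1 by ring, pow_succ]
    push_cast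
    have : (0 : ℝ) ≤ n := Nat.cast_nonneg n
    nlinarith

/-- expansion of `(1 - u) ^ k` up to third order -/
lemma aux_expand (hp : 3 ≤ p) (k : ℕ) (hk : 1 ≤ k) (u : ℚ_[p]) (hu0 : u ≠ 0) (hu : ‖u‖ < 1) :
    ∃ R : ℚ_[p], ‖R‖ < ‖(k : ℚ_[p])‖ * ‖u‖ ^ 2 ∧
      1 - (1 - u) ^ k = k * u - k * (k - 1) / 2 * u ^ 2
        + k * (k - 1) * (k - 2) / 6 * u ^ 3 + R := by
  have hk0 : (k : ℚ_[p]) ≠ 0 := by exact_mod_cast (by omega : k ≠ 0)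
  have hpos : 0 < ‖(k : ℚ_[p])‖ * ‖u‖ ^ 2 := by positivity
  have h3 := aux_third hp hu
  refine ⟨-∑ j ∈ Finset.range k, (-u) ^ (j + 4) * ((k.choose (j + 4) : ℕ) : ℚ_[p]), ?_, ?_⟩
  · rw [norm_neg]
    refine lt_of_le_of_lt (b := 4 / 9 * (‖(k : ℚ_[p])‖ * ‖u‖ ^ 2))
      (IsUltrametricDist.norm_sum_le_of_forall_le_of_nonneg (by positivity) ?_) (by linarith)
    intro j _
    rw [norm_mul, norm_pow, norm_neg]
    have h1 := aux_choose_norm (p := p) k (j + 3) hk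
    have h2 : ‖u‖ ^ (j + 2) ≤ (1 / 3) ^ (j + 2) := pow_le_pow_left₀ (norm_nonneg _) h3 _
    calc ‖u‖ ^ (j + 4) * ‖((k.choose (j + 4) : ℕ) : ℚ_[p])‖
        ≤ (‖u‖ ^ (j + 2) * ‖u‖ ^ 2) * (‖(k : ℚ_[p])‖ * ((j : ℝ) + 4)) := by
          rw [← pow_add]
          refine mul_le_mul_of_nonneg_left (h1.trans (le_of_eq ?_)) (by positivity)
          push_cast; ring
      _ ≤ ((1 / 3) ^ (j + 2) * ‖u‖ ^ 2) * (‖(k : ℚ_[p])‖ * ((j : ℝ) + 4)) := by gcongr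
      _ = (((j : ℝ) + 4) * (1 / 3) ^ (j + 2)) * (‖(k : ℚ_[p])‖ * ‖u‖ ^ 2) := by ring
      _ ≤ _ := mul_le_mul_of_nonneg_right (aux_pow_ineq j) hpos.le
  · have hs : (1 - u) ^ k = ∑ j ∈ Finset.range (k + 4),
        (-u) ^ j * ((k.choose j : ℕ) : ℚ_[p]) := by
      rw [show (1 - u) = -u + 1 by ring, add_pow]
      simp only [one_pow, mul_one]
      refine Finset.sum_subset (Finset.range_mono (by omega)) ?_
      intro j _ hj
      rw [Nat.choose_eq_zero_of_lt (by simpa using hj)]; simp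
    rw [hs, Finset.sum_range_succ', Finset.sum_range_succ', Finset.sum_range_succ',
      Finset.sum_range_succ']
    have e2 := aux_choose_two (p := p) k
    have e3 := aux_choose_three (p := p) k
    simp only [zero_add, Nat.choose_zero_right, Nat.choose_one_right, Nat.cast_one]
    norm_num [add_assoc]
    linear_combination (-u^2/2) * e2 + (u^3/6) * e3

lemma aux_two (hp : 3 ≤ p) : ‖(2 : ℚ_[p])‖ = 1 := by
  have := (Padic.norm_natCast_eq_one_iff (p := p) (n := 2)).2
    ((Nat.coprime_primes (Fact.out) Nat.prime_two).2 (by omega))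
  simpa using this

lemma aux_six (hp : 3 ≤ p) : 1 / 3 ≤ ‖(6 : ℚ_[p])‖ := by
  have h := aux_nat_lower (p := p) 3 (by norm_num)
  have : (6 : ℚ_[p]) = 2 * 3 := by norm_num
  rw [this, norm_mul, aux_two hp]
  push_cast at h
  linarith

lemma aux_int (n : ℤ) : ‖(n : ℚ_[p])‖ ≤ 1 := Padic.norm_int_le_one n

lemma aux_k1 (k : ℕ) : ‖(k : ℚ_[p]) - 1‖ ≤ 1 := by
  have := aux_int (p := p) ((k : ℤ) - 1); push_cast at this; exact this
lemma aux_k2 (k : ℕ) : ‖(k : ℚ_[p]) - 2‖ ≤ 1 := by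
  have := aux_int (p := p) ((k : ℤ) - 2); push_cast at this; exact this

lemma aux_first (hp : 3 ≤ p) (k : ℕ) (hk : 1 ≤ k) (u : ℚ_[p]) (hu0 : u ≠ 0) (hu : ‖u‖ < 1) :
    ‖(1 - (1 - u) ^ k) - k * u‖ ≤ ‖(k : ℚ_[p])‖ * ‖u‖ ^ 2 := by
  obtain ⟨R, hR, h⟩ := aux_expand hp k hk u hu0 hu
  have e : (1 - (1 - u) ^ k) - k * u = (k * u ^ 2) * (-((k - 1) / 2)
      + (k - 1) * (k - 2) * (u / 6)) + R := by rw [h]; ring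
  rw [e]
  refine aux_add_le ?_ hR.le
  rw [norm_mul, norm_mul, norm_pow]
  refine mul_le_of_le_one_right (by positivity) (aux_add_le ?_ ?_)
  · rw [norm_neg, norm_div, aux_two hp, div_one]; exact aux_k1 k
  · rw [norm_mul, norm_mul]
    refine mul_le_one₀ (mul_le_one₀ (aux_k1 k) (norm_nonneg _) (aux_k2 k)) (norm_nonneg _) ?_
    have h6 := aux_six hp
    rw [norm_div, div_le_one (by linarith)]
    exact (aux_third hp hu).trans h6

lemma aux_first_lt (hp : 3 ≤ p) (k : ℕ) (hk : 1 ≤ k) (u : ℚ_[p]) (hu0 : u ≠ 0) (hu : ‖u‖ < 1) :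
    ‖(1 - (1 - u) ^ k) - k * u‖ < ‖(k : ℚ_[p]) * u‖ := by
  have hk0 : (k : ℚ_[p]) ≠ 0 := by exact_mod_cast (by omega : k ≠ 0)
  refine (aux_first hp k hk u hu0 hu).trans_lt ?_
  rw [norm_mul, pow_two, ← mul_assoc]
  exact mul_lt_of_lt_one_right (by positivity) hu

lemma aux_root_one (hp : 3 ≤ p) (k : ℕ) (hk : 1 ≤ k) (ξ : ℚ_[p]) (h : ξ ^ k = 1)
    (h1 : ‖1 - ξ‖ < 1) : ξ = 1 := by
  by_contra hne
  have := aux_first_lt hp k hk (1 - ξ) (sub_ne_zero.2 (Ne.symm hne)) h1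
  simp [h] at this

lemma aux_root_norm (k : ℕ) (hk : 1 ≤ k) (ξ : ℚ_[p]) (h : ‖ξ ^ k‖ = 1) : ‖ξ‖ = 1 := by
  rw [norm_pow] at h
  exact (pow_eq_one_iff_of_nonneg (norm_nonneg _) (by omega)).1 h

lemma aux_root_sub (hp : 3 ≤ p) (k : ℕ) (hk : 1 ≤ k) (ξ : ℚ_[p]) (h : ξ ^ k = 1)
    (h1 : ξ ≠ 1) : ‖1 - ξ‖ = 1 := by
  have hn : ‖ξ‖ = 1 := aux_root_norm k hk ξ (by rw [h, norm_one])
  have : ‖1 - ξ‖ ≤ 1 := aux_sub_le (by simp) hn.le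
  rcases this.lt_or_eq with h2 | h2
  · exact absurd (aux_root_one hp k hk ξ h h2) h1
  · exact h2

/-- Teichmüller representative -/
lemma aux_teich (y : ℚ_[p]) (hy : ‖y‖ = 1) :
    ∃ ξ : ℚ_[p], ξ ^ (p - 1) = 1 ∧ ‖ξ - y‖ < 1 := by
  have hpp : p.Prime := Fact.out
  let a : ℤ_[p] := ⟨y, hy.le⟩
  have ha : ‖a‖ = 1 := hy
  have hz : ∀ z : ℤ_[p], PadicInt.toZMod z = 0 ↔ ‖z‖ < 1 := by
    intro z
    rw [← RingHom.mem_ker, PadicInt.ker_toZMod, IsLocalRing.mem_maximalIdeal, PadicInt.mem_nonunits]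
  let F : Polynomial ℤ_[p] := Polynomial.X ^ (p - 1) - 1
  have hd : ‖F.derivative.aeval a‖ = 1 := by
    have h1 : ‖((p - 1 : ℕ) : ℤ_[p])‖ = 1 := by
      rw [PadicInt.norm_natCast_eq_one_iff]
      exact (Nat.coprime_self_sub_right hpp.one_lt.le).2 (by simp)
    have h2 : F.derivative.aeval a = ((p - 1 : ℕ) : ℤ_[p]) * a ^ (p - 1 - 1) := by
      simp [F, Polynomial.derivative_X_pow]
    rw [h2, norm_mul, h1, norm_pow, ha]; simp
  have hF : ‖F.aeval a‖ < 1 := by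
    have h2 : F.aeval a = a ^ (p - 1) - 1 := by simp [F]
    rw [h2, ← hz, map_sub, map_pow, map_one, ZMod.pow_card_sub_one_eq_one, sub_self]
    intro h
    have := (hz a).1 h
    linarith
  obtain ⟨z, hz0, hz1, -⟩ := hensels_lemma (F := F) (a := a) (by rw [hd]; simpa using hF)
  refine ⟨z, ?_, ?_⟩
  · have : z ^ (p - 1) = 1 := by
      have : z ^ (p - 1) - 1 = 0 := by simpa [F] using hz0
      exact sub_eq_zero.1 this
    exact_mod_cast congrArg (fun w : ℤ_[p] => (w : ℚ_[p])) this
  · rw [hd] at hz1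
    exact hz1

lemma aux_mul_close {a b c d : ℚ_[p]} (ha : ‖a‖ ≤ 1) (hd : ‖d‖ ≤ 1) (h1 : ‖a - b‖ < 1)
    (h2 : ‖c - d‖ < 1) : ‖a * c - b * d‖ < 1 := by
  have : a * c - b * d = a * (c - d) + (a - b) * d := by ring
  rw [this]
  refine aux_add_lt ?_ ?_ <;> rw [norm_mul]
  · exact lt_of_le_of_lt (mul_le_of_le_one_left (norm_nonneg _) ha) h2
  · exact lt_of_le_of_lt (mul_le_of_le_one_right (norm_nonneg _) hd) h1

lemma aux_pow_close {a b : ℚ_[p]} (ha : ‖a‖ ≤ 1) (hb : ‖b‖ ≤ 1) (h1 : ‖a - b‖ < 1) (k : ℕ) :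
    ‖a ^ k - b ^ k‖ < 1 := by
  induction k with
  | zero => simp
  | succ n ih =>
    rw [pow_succ, pow_succ]
    exact aux_mul_close (by rw [norm_pow]; exact pow_le_one₀ (norm_nonneg _) ha) hb ih h1

/-- if `y ^ k` is close to `1`, then `y` is close to a `k`-th root of unity -/
lemma aux_near_root (hp : 3 ≤ p) (k : ℕ) (hk : 1 ≤ k) (y : ℚ_[p]) (h : ‖y ^ k - 1‖ < 1) :
    ∃ ξ : ℚ_[p], ξ ^ k = 1 ∧ ‖ξ - y‖ < 1 := by
  have hy : ‖y‖ = 1 := aux_root_norm k hk y (by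
    have := aux_norm_eq (a := (1 : ℚ_[p])) (b := y ^ k) (by simpa using h)
    simpa using this)
  obtain ⟨ξ, h1, h2⟩ := aux_teich y hy
  have hξ : ‖ξ‖ = 1 := aux_root_norm (p - 1) (by omega) ξ (by rw [h1, norm_one])
  refine ⟨ξ, aux_root_one hp (p - 1) (by omega) _ ?_ ?_, h2⟩
  · rw [← pow_mul, mul_comm, pow_mul, h1, one_pow]
  · have h3 := aux_pow_close hξ.le hy.le h2 k
    have e : 1 - ξ ^ k = -((ξ ^ k - y ^ k) + (y ^ k - 1)) := by ring
    rw [e, norm_neg]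
    exact aux_add_lt h3 h

lemma aux_center (hp : 3 ≤ p) (q k : ℕ) (hk : 1 ≤ k) (θ : ℚ_[p])
    (hqk : ‖(q : ℚ_[p])‖ < ‖(k : ℚ_[p])‖) (hq1 : ‖(q : ℚ_[p])‖ < 1)
    (ξ : ℚ_[p]) (hξ : ξ ^ k = 1) :
    ‖xiCenter p q k θ ξ - (1 - q)‖ ≤ ‖θ - 1‖ := by
  have h6 := aux_six hp
  unfold xiCenter
  split_ifs with h
  · rw [add_sub_cancel_left, norm_mul, norm_mul]
    refine mul_le_of_le_one_left (norm_nonneg _) (mul_le_one₀ (aux_k1 k) (norm_nonneg _) ?_)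
    refine aux_add_le (aux_sub_le (by simp) ?_) ?_
    · rw [norm_div, aux_two hp, div_one]; exact hq1.le
    · have e : ((k : ℚ_[p]) - 2) * (q : ℚ_[p]) ^ 2 / (6 * k) = (k - 2) * ((q / 6) * (q / k)) := by
        rw [div_mul_div_comm, mul_div_assoc, pow_two]
      rw [e, norm_mul, norm_mul, norm_div, norm_div]
      refine mul_le_one₀ (aux_k2 k) (by positivity) (mul_le_one₀ ?_ (by positivity) ?_)
      · exact div_le_one_of_le₀ ((aux_third hp hq1).trans h6) (norm_nonneg _)
      · exact div_le_one_of_le₀ hqk.le (norm_nonneg _)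
  · have e : 2 - (q : ℚ_[p]) - θ + q * (θ - 1) / (1 - ξ) - (1 - q)
        = -(θ - 1) + q * (θ - 1) / (1 - ξ) := by ring
    rw [e]
    refine aux_add_le (by rw [norm_neg]) ?_
    rw [norm_div, aux_root_sub hp k hk ξ hξ h, div_one, norm_mul]
    exact mul_le_of_le_one_left (norm_nonneg _) hq1.le

/-- the key estimate in the case where `y = 1 - u` is close to `1` -/
lemma aux_main_one (hp : 3 ≤ p) (k : ℕ) (hk : 1 ≤ k) (Q t u : ℚ_[p])
    (hQ0 : Q ≠ 0) (hQk : ‖Q‖ < ‖(k : ℚ_[p])‖) (hQ1 : ‖Q‖ < 1)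
    (ht : ‖t‖ < ‖Q‖ ^ 2) (hu : ‖u‖ < 1) (hw : ‖(1 - u) ^ k - (1 - Q)‖ ≤ ‖t‖) :
    ‖(Q + t) / (u + t) - 1 - (k - 1) * (1 - Q / 2 + (k - 2) * Q ^ 2 / (6 * k))‖ < ‖Q‖ := by
  have hk0 : (k : ℚ_[p]) ≠ 0 := by exact_mod_cast (by omega : k ≠ 0)
  have hQp : 0 < ‖Q‖ := norm_pos_iff.2 hQ0
  have hkp : 0 < ‖(k : ℚ_[p])‖ := norm_pos_iff.2 hk0
  have hk1 : ‖(k : ℚ_[p])‖ ≤ 1 := aux_nat_le k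
  have htQ : ‖t‖ < ‖Q‖ := ht.trans (by nlinarith)
  have h6 := aux_six hp
  have h60 : (6 : ℚ_[p]) ≠ 0 := by norm_num
  have h20 : (2 : ℚ_[p]) ≠ 0 := by norm_num
  have hu0 : u ≠ 0 := by
    rintro rfl
    have : (1 - 0 : ℚ_[p]) ^ k - (1 - Q) = Q := by simp
    rw [this] at hw; linarith
  set w := 1 - (1 - u) ^ k with hwdef
  have hwQ : ‖w - Q‖ ≤ ‖t‖ := by
    have : w - Q = -((1 - u) ^ k - (1 - Q)) := by rw [hwdef]; ring
    rw [this, norm_neg]; exact hw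
  have hw1 : ‖w‖ = ‖Q‖ := aux_norm_eq (hwQ.trans_lt htQ)
  have hlt : ‖w - k * u‖ < ‖(k : ℚ_[p]) * u‖ := aux_first_lt hp k hk u hu0 hu
  have hku : ‖(k : ℚ_[p])‖ * ‖u‖ = ‖Q‖ := by
    rw [← norm_mul, ← hw1]; exact (aux_norm_eq hlt).symm
  have hup : 0 < ‖u‖ := norm_pos_iff.2 hu0
  have hQu : ‖Q‖ ≤ ‖u‖ := by rw [← hku]; exact mul_le_of_le_one_left hup.le hk1
  have hQku : ‖Q - k * u‖ < ‖Q‖ := by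
    have : Q - k * u = (w - k * u) - (w - Q) := by ring
    rw [this]
    refine aux_sub_lt ?_ (hwQ.trans_lt htQ)
    rwa [norm_mul, hku] at hlt
  have htu : ‖t‖ < ‖u‖ := htQ.trans_le hQu
  have hut : ‖u + t‖ = ‖u‖ := aux_norm_eq (by rwa [add_sub_cancel_left])
  have hut0 : u + t ≠ 0 := by rw [← norm_pos_iff, hut]; exact hup
  have htu2 : ‖t‖ < ‖Q‖ * ‖u‖ := ht.trans_le (by nlinarith)
  obtain ⟨R, hR, hexp⟩ := aux_expand hp k hk u hu0 hu
  rw [← hwdef] at hexp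
  have e : (Q + t) / (u + t) - 1 - (k - 1) * (1 - Q / 2 + (k - 2) * Q ^ 2 / (6 * k))
      = t * (u - Q) / (u * (u + t)) - (w - Q) / u + (k - 1) * ((Q - k * u) / 2)
        - (k - 1) * (k - 2) * ((Q - k * u) * ((Q + k * u) / (6 * k))) + R / u := by
    have hR' : R = w - (k * u - k * (k - 1) / 2 * u ^ 2
        + k * (k - 1) * (k - 2) / 6 * u ^ 3) := by rw [hexp]; ring
    rw [hR']
    clear_value w
    field_simp
    ring
  rw [e]
  refine aux_add_lt (aux_sub_lt (aux_add_lt (aux_sub_lt ?_ ?_) ?_) ?_) ?_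
  · rw [norm_div, norm_mul, norm_mul, hut, div_lt_iff₀ (by positivity)]
    have h1 : ‖u - Q‖ ≤ ‖u‖ := aux_sub_le le_rfl hQu
    calc ‖t‖ * ‖u - Q‖ ≤ ‖t‖ * ‖u‖ := by gcongr
      _ < (‖Q‖ * ‖u‖) * ‖u‖ := by gcongr
      _ = _ := by ring
  · rw [norm_div, div_lt_iff₀ hup]; exact hwQ.trans_lt htu2
  · rw [norm_mul, norm_div, aux_two hp, div_one]
    exact (mul_le_of_le_one_left (norm_nonneg _) (aux_k1 k)).trans_lt hQku
  · rw [norm_mul, norm_mul]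
    refine (mul_le_of_le_one_left (norm_nonneg _)
      (mul_le_one₀ (aux_k1 k) (norm_nonneg _) (aux_k2 k))).trans_lt ?_
    rw [norm_mul]
    refine (mul_le_of_le_one_right (norm_nonneg _) ?_).trans_lt hQku
    have h1 : ‖Q + k * u‖ ≤ ‖Q‖ := aux_add_le le_rfl (by rw [norm_mul, hku])
    rw [norm_div, norm_mul, div_le_one (by positivity)]
    refine h1.trans ?_
    rw [← hku, mul_comm]
    exact mul_le_mul_of_nonneg_right ((aux_third hp hu).trans h6) hkp.le
  · rw [norm_div, div_lt_iff₀ hup, ← hku]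
    calc ‖R‖ < _ := hR
      _ = _ := by ring

end Helpers

theorem stmt14 (p : ℕ) [Fact p.Prime] (hp : 3 ≤ p) (q k : ℕ) (hq : 1 ≤ q) (hk : 1 ≤ k)
    (θ : ℚ_[p]) (hqk : ‖(q : ℚ_[p])‖ < ‖(k : ℚ_[p])‖)
    (hθq : ‖θ - 1‖ < ‖(q : ℚ_[p])‖ ^ 2) (hq2 : ‖(q : ℚ_[p])‖ ^ 2 < 1) :
    ∀ x : ℚ_[p], x ≠ 2 - (q : ℚ_[p]) - θ →
      pottsBethe p q k θ x ∈ XSet p q k θ → x ∈ XSet p q k θ := by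
  rintro x hx ⟨ζ, hζ, hf⟩
  have hq1 : ‖(q : ℚ_[p])‖ < 1 := by
    have := norm_nonneg (q : ℚ_[p]); nlinarith
  have hr : 0 < ‖(q : ℚ_[p]) * (θ - 1)‖ := (norm_nonneg _).trans_lt hf
  have hq0 : (q : ℚ_[p]) ≠ 0 := fun h => by simp [h] at hr
  have ht0 : θ - 1 ≠ 0 := fun h => by simp [h] at hr
  have hqp : 0 < ‖(q : ℚ_[p])‖ := norm_pos_iff.2 hq0
  have htq : ‖θ - 1‖ < ‖(q : ℚ_[p])‖ := hθq.trans (by nlinarith)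
  have hxd : x + θ + (q : ℚ_[p]) - 2 ≠ 0 := fun h => hx (by linear_combination h)
  unfold pottsBethe at hf
  set y := (θ * x + (q : ℚ_[p]) - 1) / (x + θ + (q : ℚ_[p]) - 2) with hy
  have hyd : y * (x + θ + (q : ℚ_[p]) - 2) = θ * x + (q : ℚ_[p]) - 1 := by
    rw [hy]; exact div_mul_cancel₀ _ hxd
  clear_value y
  -- `y ^ k` is within `‖θ - 1‖` of `1 - q`
  have hyk : ‖y ^ k - (1 - q)‖ ≤ ‖θ - 1‖ := by
    have e : y ^ k - (1 - q) = (y ^ k - xiCenter p q k θ ζ) + (xiCenter p q k θ ζ - (1 - q)) := by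
      ring
    rw [e]
    refine aux_add_le (hf.le.trans ?_) (aux_center hp q k hk θ hqk hq1 ζ hζ)
    rw [norm_mul]
    exact mul_le_of_le_one_left (norm_nonneg _) hq1.le
  have hyk1 : ‖y ^ k - 1‖ < 1 := by
    have e : y ^ k - 1 = (y ^ k - (1 - q)) - q := by ring
    rw [e]
    exact aux_sub_lt (hyk.trans_lt (htq.trans hq1)) hq1
  -- solve for `x`
  have hqt : (q : ℚ_[p]) + (θ - 1) ≠ 0 := by
    rw [← norm_pos_iff, aux_norm_eq (a := (q : ℚ_[p])) (by rwa [add_sub_cancel_left])]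
    exact hqp
  have hd : (x + θ + (q : ℚ_[p]) - 2) * ((1 - y) + (θ - 1)) = (θ - 1) * (q + (θ - 1)) := by
    linear_combination -hyd
  have hyt : (1 - y) + (θ - 1) ≠ 0 := by
    intro h
    rw [h, mul_zero] at hd
    exact mul_ne_zero ht0 hqt hd.symm
  have hxs : x = 2 - q - θ + (θ - 1) * ((q + (θ - 1)) / ((1 - y) + (θ - 1))) := by
    rw [← mul_div_assoc, ← hd, mul_div_cancel_right₀ _ hyt]; ring
  obtain ⟨ξ, hξ, hξy⟩ := aux_near_root hp k hk y hyk1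
  refine ⟨ξ, hξ, ?_⟩
  unfold xiCenter
  split_ifs with h
  · have hm := aux_main_one hp k hk (q : ℚ_[p]) (θ - 1) (1 - y) hq0 hqk hq1 hθq
      (by rwa [← h]) (by rwa [sub_sub_cancel])
    have e : ∀ D C : ℚ_[p], (2 - q - θ + (θ - 1) * D) - (1 - q + (k - 1) * C * (θ - 1))
        = (D - 1 - (k - 1) * C) * (θ - 1) := by intro D C; ring
    rw [hxs, e, norm_mul, norm_mul]
    exact mul_lt_mul_of_pos_right hm (norm_pos_iff.2 ht0)
  · have h1 : ‖1 - ξ‖ = 1 := aux_root_sub hp k hk ξ hξ h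
    have h10 : 1 - ξ ≠ 0 := by rw [← norm_pos_iff, h1]; exact one_pos
    have h2 : ‖(1 - y) + (θ - 1)‖ = 1 := by
      rw [← h1]
      refine aux_norm_eq ?_
      rw [h1]
      have e : (1 - y) + (θ - 1) - (1 - ξ) = (ξ - y) + (θ - 1) := by ring
      rw [e]
      exact aux_add_lt hξy (htq.trans hq1)
    have e : x - (2 - q - θ + q * (θ - 1) / (1 - ξ)) = (θ - 1) *
        ((((θ - 1) * (1 - ξ) - q * (θ - 1)) - q * (ξ - y)) /
          (((1 - y) + (θ - 1)) * (1 - ξ))) := by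
      rw [hxs]
      field_simp
      ring
    rw [e, norm_mul, norm_div, norm_mul ((1 - y) + (θ - 1)), h1, h2, mul_one, div_one, norm_mul,
      mul_comm]
    refine mul_lt_mul_of_pos_right (aux_sub_lt (aux_sub_lt ?_ ?_) ?_) (norm_pos_iff.2 ht0)
    · rw [norm_mul, h1, mul_one]; exact htq
    · rw [norm_mul]; exact mul_lt_of_lt_one_right hqp (htq.trans hq1)
    · rw [norm_mul]; exact mul_lt_of_lt_one_right hqp hξy
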